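/- arXiv:1807.11011 — 3 statements merged into one kernel-verified Lean document; each statement's English description precedes it below -/
import Mathlib

section
/- Let L be a d-generator generalized Heisenberg Lie algebra over a field k with d ≥ 3 and dim L² = ½d(d−1) − 1. Then the subspace K of L² ⊗ (L/L²) spanned by the elements [x,y]⊗(z+L²) + [z,x]⊗(y+L²) + [y,z]⊗(x+L²) for x, y, z ∈ L has dimension exactly (1/6)d(d−1)(d−2). -/
open Module TensorProduct

variable (k : Type*) [Field k]

/-- The derived subalgebra `L² = [L,L]` of a Lie algebra, as a `k`-submodule. -/
abbrev lieSq (L : Type*) [LieRing L] [LieAlgebra k L] : Submodule k L :=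
  (LieModule.lowerCentralSeries k L L 1).toSubmodule

lemma lie_mem_lieSq {L : Type*} [LieRing L] [LieAlgebra k L] (x y : L) :
    ⁅x, y⁆ ∈ lieSq k L := by
  have : ⁅x, y⁆ ∈ LieModule.lowerCentralSeries k L L 1 := by
    rw [LieModule.lowerCentralSeries_succ, LieModule.lowerCentralSeries_zero]
    exact LieSubmodule.lie_mem_lie (LieSubmodule.mem_top x) (LieSubmodule.mem_top y)
  exact this

/-- The subspace `K` of `L² ⊗ (L/L²)` spanned by the elements
`[x,y]⊗z̄ + [z,x]⊗ȳ + [y,z]⊗x̄`. -/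
abbrev Ksub (L : Type*) [LieRing L] [LieAlgebra k L] :
    Submodule k (TensorProduct k (lieSq k L) (L ⧸ lieSq k L)) :=
  Submodule.span k
    { t | ∃ x y z : L,
      t = (⟨⁅x, y⁆, lie_mem_lieSq k x y⟩ : lieSq k L) ⊗ₜ[k]
            (Submodule.Quotient.mk z : L ⧸ lieSq k L)
        + (⟨⁅z, x⁆, lie_mem_lieSq k z x⟩ : lieSq k L) ⊗ₜ[k]
            (Submodule.Quotient.mk y : L ⧸ lieSq k L)
        + (⟨⁅y, z⁆, lie_mem_lieSq k y z⟩ : lieSq k L) ⊗ₜ[k]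
            (Submodule.Quotient.mk x : L ⧸ lieSq k L) }

lemma update_vec_two_one {α : Type*} (x y z : α) : Function.update ![x, y] 1 z = ![x, z] := by
  ext i
  fin_cases i <;> rfl

lemma update_fin_three {α : Type*} (v : Fin 3 → α) (z : α) :
    Function.update v 0 z = ![z, v 1, v 2] ∧ Function.update v 1 z = ![v 0, z, v 2] ∧
      Function.update v 2 z = ![v 0, v 1, z] := by
  refine ⟨?_, ?_, ?_⟩ <;> (ext i; fin_cases i <;> rfl)

section JacobiMap

variable {V W : Type*} [AddCommGroup V] [Module k V] [AddCommGroup W] [Module k W]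

/-- The alternating map of two variables attached to an alternating bilinear map. -/
def LinearMap.IsAlt.toAlternatingMap {c : V →ₗ[k] V →ₗ[k] W} (hc : c.IsAlt) :
    V [⋀^Fin 2]→ₗ[k] W where
  toFun v := c (v 0) (v 1)
  map_update_add' := by
    intro inst v i x y
    rw [Subsingleton.elim inst (instDecidableEqFin 2)]
    fin_cases i <;> simp
  map_update_smul' := by
    intro inst v i a x
    rw [Subsingleton.elim inst (instDecidableEqFin 2)]
    fin_cases i <;> simp
  map_eq_zero_of_eq' v i j h hij := by
    have h01 : v 0 = v 1 := by
      fin_cases i <;> fin_cases j <;> simp_all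
    rw [h01, hc]

/-- The alternating map `(x, y, z) ↦ c(x,y)⊗z + c(z,x)⊗y + c(y,z)⊗x` attached to an alternating
bilinear map `c`. -/
noncomputable def LinearMap.IsAlt.cyclicTensor {c : V →ₗ[k] V →ₗ[k] W} (hc : c.IsAlt) :
    V [⋀^Fin 3]→ₗ[k] W ⊗[k] V where
  toFun v := c (v 0) (v 1) ⊗ₜ v 2 + c (v 2) (v 0) ⊗ₜ v 1 + c (v 1) (v 2) ⊗ₜ v 0
  map_update_add' := by
    intro inst v i x y
    rw [Subsingleton.elim inst (instDecidableEqFin 3)]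
    obtain rfl | rfl | rfl : i = 0 ∨ i = 1 ∨ i = 2 := by omega
    all_goals
      simp [update_fin_three, add_tmul, tmul_add, -Fin.reduceEq]
      abel
  map_update_smul' := by
    intro inst v i a x
    rw [Subsingleton.elim inst (instDecidableEqFin 3)]
    obtain rfl | rfl | rfl : i = 0 ∨ i = 1 ∨ i = 2 := by omega
    all_goals simp [update_fin_three, smul_tmul', -Fin.reduceEq]
  map_eq_zero_of_eq' v i j h hij := by
    have key (x y : V) : c x y ⊗ₜ[k] x + c y x ⊗ₜ[k] x = 0 := by
      rw [← add_tmul, ← hc.neg x y, add_neg_cancel, zero_tmul]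
    have key' (x y : V) : c x y ⊗ₜ[k] y + c y x ⊗ₜ[k] y = 0 := by
      rw [add_comm, key]
    fin_cases i <;> fin_cases j <;> first
      | exact absurd rfl hij
      | (clear hij; simp_all [hc.self_eq_zero, add_comm])

variable (V) in
/-- The exterior product of two vectors, as a bilinear map. -/
noncomputable def wedge : V →ₗ[k] V →ₗ[k] ⋀[k]^2 V :=
  LinearMap.mk₂ k (fun x y => exteriorPower.ιMulti k 2 ![x, y])
    (fun x x' y => by simp [AlternatingMap.map_vecCons_add])
    (fun a x y => by simp [AlternatingMap.map_vecCons_smul])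
    (fun x y y' => by
      simpa only [update_vec_two_one] using
        (exteriorPower.ιMulti k 2 (M := V)).map_update_add ![x, 0] 1 y y')
    (fun a x y => by
      simpa only [update_vec_two_one] using
        (exteriorPower.ιMulti k 2 (M := V)).map_update_smul ![x, 0] 1 a y)

lemma wedge_isAlt : (wedge k V).IsAlt := fun x =>
  (exteriorPower.ιMulti k 2 (M := V)).map_eq_zero_of_eq ![x, x] (i := 0) (j := 1) rfl (by simp)

/-- Contraction of the second factor of a tensor product against a linear form. -/
noncomputable def contractSnd (W : Type*) [AddCommGroup W] [Module k W] (f : Dual k V) :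
    W ⊗[k] V →ₗ[k] W :=
  (TensorProduct.rid k W).toLinearMap ∘ₗ f.lTensor W

@[simp] lemma contractSnd_tmul (f : Dual k V) (w : W) (v : V) :
    contractSnd k W f (w ⊗ₜ v) = f v • w := by
  simp [contractSnd]

open exteriorPower

lemma contractSnd_cyclicTensor {c : V →ₗ[k] V →ₗ[k] W} (hc : c.IsAlt) (f : Dual k V)
    (ξ : ⋀[k]^3 V) :
    alternatingMapLinearEquiv hc.toAlternatingMap
        (contractSnd k _ f (alternatingMapLinearEquiv (wedge_isAlt k).cyclicTensor ξ)) =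
      contractSnd k _ f (alternatingMapLinearEquiv hc.cyclicTensor ξ) := by
  simp only [← LinearMap.comp_apply]
  congr 1
  ext v
  simp [LinearMap.IsAlt.cyclicTensor, LinearMap.IsAlt.toAlternatingMap, wedge]

lemma pairingDual_contractSnd_cyclicTensor (f g h : Dual k V) (ξ : ⋀[k]^3 V) :
    pairingDual k V 2 (ιMulti k 2 ![f, g])
        (contractSnd k _ h (alternatingMapLinearEquiv (wedge_isAlt k).cyclicTensor ξ)) =
      pairingDual k V 3 (ιMulti k 3 ![f, g, h]) ξ := by
  simp only [← LinearMap.comp_apply]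
  congr 1
  ext v
  simp [LinearMap.IsAlt.cyclicTensor, wedge, Matrix.det_fin_two, Matrix.det_fin_three]
  ring

lemma exists_smul_eq_of_finrank_ker_le_one [FiniteDimensional k V] (φ : V →ₗ[k] W)
    (h : finrank k φ.ker ≤ 1) : ∃ ω : V, ∀ η, φ η = 0 → ∃ a : k, a • ω = η := by
  obtain ⟨ω, hω⟩ := finrank_le_one_iff.mp h
  refine ⟨ω, fun η hη => ?_⟩
  obtain ⟨a, ha⟩ := hω ⟨η, hη⟩
  exact ⟨a, congrArg Subtype.val ha⟩

/-- If the kernel of the map `⋀²V → W` induced by `c` is at most one-dimensional, then the map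
`⋀³V → W ⊗ V` induced by `c` is injective. -/
lemma LinearMap.IsAlt.cyclicTensor_injective {c : V →ₗ[k] V →ₗ[k] W} (hc : c.IsAlt)
    [FiniteDimensional k V]
    (hker : finrank k (alternatingMapLinearEquiv hc.toAlternatingMap).ker ≤ 1) :
    Function.Injective (alternatingMapLinearEquiv hc.cyclicTensor) := by
  rw [injective_iff_map_eq_zero]
  intro ξ hξ
  obtain ⟨ω, hω⟩ := exists_smul_eq_of_finrank_ker_le_one k _ hker
  have hη (h : Dual k V) : ∃ a : k,
      a • ω = contractSnd k _ h (alternatingMapLinearEquiv (wedge_isAlt k).cyclicTensor ξ) :=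
    hω _ (by rw [contractSnd_cyclicTensor k hc h ξ, hξ, map_zero])
  choose a ha using hη
  have hs (f g h : Dual k V) : pairingDual k V 3 (ιMulti k 3 ![f, g, h]) ξ =
      a h * pairingDual k V 2 (ιMulti k 2 ![f, g]) ω := by
    rw [← pairingDual_contractSnd_cyclicTensor, ← ha, map_smul, smul_eq_mul]
  have hs0 (f g h : Dual k V) : pairingDual k V 3 (ιMulti k 3 ![f, g, h]) ξ = 0 := by
    have hself : ιMulti k 3 ![f, g, g] = 0 :=
      AlternatingMap.map_eq_zero_of_eq _ _ (i := 1) (j := 2) rfl (by simp)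
    have hswap : ιMulti k 3 ![f, h, g] = -ιMulti k 3 ![f, g, h] := by
      rw [← AlternatingMap.map_swap _ _ (i := 1) (j := 2) (by simp)]
      congr 1
      ext i
      fin_cases i <;> rfl
    have h1 := hs f g g
    have h2 := hs f h g
    rw [hself, map_zero, LinearMap.zero_apply, eq_comm, mul_eq_zero] at h1
    rcases h1 with h1 | h1
    · rwa [hswap, map_neg, LinearMap.neg_apply, h1, zero_mul, neg_eq_zero] at h2
    · rw [hs, h1, mul_zero]
  let b := finBasis k V
  refine (b.exteriorPower 3).ext_elem fun s => ?_
  rw [basis_repr_apply, map_zero, Finsupp.zero_apply, ιMultiDual, ιMulti_family]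
  convert hs0 _ _ _ using 4
  exact (List.ofFn_injective rfl :
    b.coord ∘ Set.powersetCard.ofFinEmbEquiv.symm s =
      ![b.coord (Set.powersetCard.ofFinEmbEquiv.symm s 0),
        b.coord (Set.powersetCard.ofFinEmbEquiv.symm s 1),
        b.coord (Set.powersetCard.ofFinEmbEquiv.symm s 2)])

lemma range_alternatingMapLinearEquiv {n : ℕ} (f : V [⋀^Fin n]→ₗ[k] W) :
    LinearMap.range (alternatingMapLinearEquiv f) = Submodule.span k (Set.range f) := by
  rw [LinearMap.range_eq_map, ← ιMulti_span, Submodule.map_span, ← Set.range_comp]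
  congr 2
  ext v
  simp

end JacobiMap

section LieBracket

variable (L : Type*) [LieRing L] [LieAlgebra k L]

/-- The Lie bracket, as a bilinear map to the derived subalgebra. -/
def bracketToLieSq : L →ₗ[k] L →ₗ[k] lieSq k L :=
  LinearMap.mk₂ k (fun x y => ⟨⁅x, y⁆, lie_mem_lieSq k x y⟩)
    (fun x x' y => Subtype.ext (by simp)) (fun a x y => Subtype.ext (by simp))
    (fun x y y' => Subtype.ext (by simp)) (fun a x y => Subtype.ext (by simp))

variable {L} (hL : LieModule.lowerCentralSeries k L L 1 ≤ LieAlgebra.center k L)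
include hL

lemma lie_eq_zero_of_mem_lieSq {y : L} (hy : y ∈ lieSq k L) (x : L) : ⁅x, y⁆ = 0 :=
  (LieModule.mem_maxTrivSubmodule k L L y).mp (hL hy) x

/-- The bilinear map on the abelianization induced by the Lie bracket of a Lie algebra of
nilpotency class at most two. -/
noncomputable def quotientBracket : (L ⧸ lieSq k L) →ₗ[k] (L ⧸ lieSq k L) →ₗ[k] lieSq k L :=
  (lieSq k L).liftQ
    ((lieSq k L).liftQ (bracketToLieSq k L).flip (fun y hy => by
      ext x
      simpa [bracketToLieSq] using lie_eq_zero_of_mem_lieSq k hL hy x)).flip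
    (fun x hx => by
      ext y
      have h := lie_eq_zero_of_mem_lieSq k hL hx y
      rw [← lie_skew, neg_eq_zero] at h
      simpa [bracketToLieSq] using h)

lemma quotientBracket_mk (x y : L) :
    quotientBracket k hL (Submodule.Quotient.mk x) (Submodule.Quotient.mk y) =
      ⟨⁅x, y⁆, lie_mem_lieSq k x y⟩ := rfl

lemma quotientBracket_isAlt : (quotientBracket k hL).IsAlt := by
  intro x
  induction x using Submodule.Quotient.induction_on with
  | _ x => simp [quotientBracket_mk]

open exteriorPower

lemma range_quotientBracket :
    LinearMap.range (alternatingMapLinearEquiv (quotientBracket_isAlt k hL).toAlternatingMap) =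
      ⊤ := by
  apply Submodule.map_injective_of_injective (lieSq k L).injective_subtype
  rw [Submodule.map_top, Submodule.range_subtype, range_alternatingMapLinearEquiv,
    Submodule.map_span]
  apply le_antisymm
  · rw [Submodule.span_le]
    rintro _ ⟨w, -, rfl⟩
    exact w.2
  · change (LieModule.lowerCentralSeries k L L 1).toSubmodule ≤ _
    rw [LieModule.lowerCentralSeries_succ, LieModule.lowerCentralSeries_zero,
      LieSubmodule.lieIdeal_oper_eq_linear_span']
    apply Submodule.span_mono
    rintro _ ⟨x, -, y, -, rfl⟩
    exact ⟨_, ⟨![Submodule.Quotient.mk x, Submodule.Quotient.mk y], rfl⟩, rfl⟩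

lemma Ksub_eq_range :
    Ksub k L = LinearMap.range
      (alternatingMapLinearEquiv (quotientBracket_isAlt k hL).cyclicTensor) := by
  rw [range_alternatingMapLinearEquiv]
  refine congrArg (Submodule.span k) (Set.ext fun t => ?_)
  constructor
  · rintro ⟨x, y, z, rfl⟩
    exact ⟨![Submodule.Quotient.mk x, Submodule.Quotient.mk y, Submodule.Quotient.mk z], rfl⟩
  · rintro ⟨v, rfl⟩
    obtain ⟨x, hx⟩ := Submodule.Quotient.mk_surjective _ (v 0)
    obtain ⟨y, hy⟩ := Submodule.Quotient.mk_surjective _ (v 1)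
    obtain ⟨z, hz⟩ := Submodule.Quotient.mk_surjective _ (v 2)
    refine ⟨x, y, z, ?_⟩
    simp only [← quotientBracket_mk k hL, hx, hy, hz]
    rfl

end LieBracket

/-- For a `d`-generator generalized Heisenberg Lie algebra with `d ≥ 3` and `dim L² = ½d(d−1) − 1`, the subspace `K` has dimension `d(d−1)(d−2)/6`. -/
theorem stmt5 (L : Type*) [LieRing L] [LieAlgebra k L] [FiniteDimensional k L]
    (d : ℕ) (hd3 : 3 ≤ d)
    (hH : LieModule.lowerCentralSeries k L L 1 = LieAlgebra.center k L)
    (hgen : finrank k (L ⧸ lieSq k L) = d)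
    (hrk : finrank k (lieSq k L) = d * (d - 1) / 2 - 1) :
    finrank k (Ksub k L) = d * (d - 1) * (d - 2) / 6 := by
  have hL := hH.le
  have hchoose : d * (d - 1) / 2 = d.choose 2 := (Nat.choose_two_right d).symm
  have hpos : 0 < d.choose 2 := Nat.choose_pos (by omega)
  have hrank := (exteriorPower.alternatingMapLinearEquiv
    (quotientBracket_isAlt k hL).toAlternatingMap).finrank_range_add_finrank_ker
  rw [range_quotientBracket, finrank_top, hrk, exteriorPower.finrank_eq, hgen, hchoose] at hrank
  rw [Ksub_eq_range k hL, LinearMap.finrank_range_of_inj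
    ((quotientBracket_isAlt k hL).cyclicTensor_injective k (by omega)),
    exteriorPower.finrank_eq, hgen, Nat.choose_eq_descFactorial_div_factorial]
  simp [Nat.descFactorial, Nat.factorial, mul_comm]
end

section
/- Let L be a d-generator generalized Heisenberg Lie algebra over a field k with d ≥ 3 and dim L² = ½d(d−1) − 1, and set μ = dim M(L) = (1/3)d(d−1)(d+1) − d + 1. A finite-dimensional Lie algebra L* over k is a cover of L if and only if one of the following two cases holds: (a) L* is nilpotent of class exactly 3, dim (L*)³ = μ, Z(L*) ⊆ (L*)², and L*/(L*)³ ≅ L; or (b) L* is nilpotent of class exactly 3, dim (L*)³ = μ − 1, Z(L*) ⊆ (L*)², and there exists a one-dimensional central ideal J of L* with J ∩ (L*)³ = 0 such that L*/((L*)³ + J) ≅ L. -/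
open Module

variable (k : Type*) [Field k]

section CoverLemmas

variable {k} {K : Type*} [LieRing K] [LieAlgebra k K]

/-- Modulo `[K², K]`, the derived subalgebra is spanned by brackets of lifts of a spanning family
of `K / K²`. -/
lemma lieSq_le_span_sup {n : ℕ} (x : Fin n → K)
    (hx : Submodule.span k (Set.range x) ⊔ lieSq k K = ⊤) :
    lieSq k K ≤ Submodule.span k
        (Set.range fun p : (i : Fin n) × Fin i ↦ ⁅x p.1, x (p.2.castLE p.1.isLt.le)⁆) ⊔
      (LieModule.lowerCentralSeries k K K 2).toSubmodule := by
  set S := Submodule.span k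
    (Set.range fun p : (i : Fin n) × Fin i ↦ ⁅x p.1, x (p.2.castLE p.1.isLt.le)⁆)
  set D := (LieModule.lowerCentralSeries k K K 2).toSubmodule
  have lt_mem (i j : Fin n) (hij : j < i) : ⁅x i, x j⁆ ∈ S :=
    Submodule.subset_span ⟨⟨i, ⟨j, hij⟩⟩, rfl⟩
  have basis_mem (i j : Fin n) : ⁅x i, x j⁆ ∈ S := by
    rcases lt_trichotomy i j with h | rfl | h
    · rw [← lie_skew]
      exact S.neg_mem (lt_mem j i h)
    · simp
    · exact lt_mem i j h
  have right_mem (a b : K) (hb : b ∈ lieSq k K) : ⁅a, b⁆ ∈ D :=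
    LieSubmodule.lie_mem_lie (LieSubmodule.mem_top (R := k) (L := K) a) hb
  have left_mem (a b : K) (ha : a ∈ lieSq k K) : ⁅a, b⁆ ∈ D := by
    rw [← lie_skew]
    exact D.neg_mem (right_mem b a ha)
  have span_mem (a b : K) (ha : a ∈ Submodule.span k (Set.range x))
      (hb : b ∈ Submodule.span k (Set.range x)) : ⁅a, b⁆ ∈ S := by
    induction ha, hb using Submodule.span_induction₂ with
    | mem_mem a b ha hb =>
      obtain ⟨i, rfl⟩ := ha
      obtain ⟨j, rfl⟩ := hb
      exact basis_mem i j
    | zero_left => simp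
    | zero_right => simp
    | add_left a b c _ _ _ h₁ h₂ => rw [add_lie]; exact S.add_mem h₁ h₂
    | add_right a b c _ _ _ h₁ h₂ => rw [lie_add]; exact S.add_mem h₁ h₂
    | smul_left r a b _ _ h => rw [smul_lie]; exact S.smul_mem r h
    | smul_right r a b _ _ h => rw [lie_smul]; exact S.smul_mem r h
  have lie_mem (a b : K) : ⁅a, b⁆ ∈ S ⊔ D := by
    obtain ⟨a₁, ha₁, a₂, ha₂, rfl⟩ := Submodule.mem_sup.1 (hx ▸ Submodule.mem_top (x := a))
    obtain ⟨b₁, hb₁, b₂, hb₂, rfl⟩ := Submodule.mem_sup.1 (hx ▸ Submodule.mem_top (x := b))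
    rw [add_lie, lie_add, add_assoc]
    exact Submodule.add_mem_sup (span_mem a₁ b₁ ha₁ hb₁)
      (D.add_mem (right_mem a₁ b₂ hb₂) (left_mem a₂ _ ha₂))
  change (⁅(⊤ : LieIdeal k K), (⊤ : LieIdeal k K)⁆ : LieIdeal k K).toSubmodule ≤ S ⊔ D
  rw [LieSubmodule.lieIdeal_oper_eq_linear_span', Submodule.span_le]
  rintro _ ⟨a, -, b, -, rfl⟩
  exact lie_mem a b

/-- For a surjective Lie algebra morphism whose kernel lies in the derived subalgebra, the
preimage of the derived subalgebra is the derived subalgebra. -/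
lemma comap_lowerCentralSeries_one {L : Type*} [LieRing L] [LieAlgebra k L] {f : K →ₗ⁅k⁆ L}
    (hf : Function.Surjective f) (hker : f.ker ≤ LieModule.lowerCentralSeries k K K 1) :
    LieIdeal.comap f (LieModule.lowerCentralSeries k L L 1) =
      LieModule.lowerCentralSeries k K K 1 := by
  rw [← LieIdeal.lowerCentralSeries_map_eq 1 hf, LieIdeal.comap_map_eq, sup_eq_left.2 hker]
  exact congrArg SetLike.coe (LieIdeal.coe_map_of_surjective hf)

variable [FiniteDimensional k K]

lemma finrank_lieSq_le :
    finrank k (lieSq k K) ≤ finrank k (LieModule.lowerCentralSeries k K K 2).toSubmodule +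
      finrank k (K ⧸ lieSq k K) * (finrank k (K ⧸ lieSq k K) - 1) / 2 := by
  set n := finrank k (K ⧸ lieSq k K)
  let b : Basis (Fin n) k (K ⧸ lieSq k K) := finBasis k _
  choose x hx using fun i ↦ (lieSq k K).mkQ_surjective (b i)
  have hspan : Submodule.span k (Set.range x) ⊔ lieSq k K = ⊤ := by
    have hrange : (lieSq k K).mkQ '' Set.range x = Set.range b := by
      rw [← Set.range_comp]
      exact congrArg Set.range (funext hx)
    rw [← (lieSq k K).ker_mkQ, ← Submodule.comap_map_eq, Submodule.map_span, hrange, b.span_eq,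
      Submodule.comap_top]
  have hcard : Fintype.card ((i : Fin n) × Fin i) = n * (n - 1) / 2 := by
    rw [Fintype.card_sigma, ← Finset.sum_range_id]
    simp [Finset.sum_range]
  have h₁ := Submodule.finrank_mono (lieSq_le_span_sup x hspan)
  have h₂ := finrank_range_le_card (R := k)
    fun p : (i : Fin n) × Fin i ↦ ⁅x p.1, x (p.2.castLE p.1.isLt.le)⁆
  rw [hcard] at h₂
  have h₃ := Submodule.finrank_add_le_finrank_add_finrank (Submodule.span k
      (Set.range fun p : (i : Fin n) × Fin i ↦ ⁅x p.1, x (p.2.castLE p.1.isLt.le)⁆))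
    (LieModule.lowerCentralSeries k K K 2).toSubmodule
  unfold Set.finrank at h₂
  omega

/-- A central ideal inside a larger central ideal has a complement that is again an ideal. -/
lemma exists_central_complement {A B : LieIdeal k K} (hAB : A ≤ B)
    (hB : B ≤ LieAlgebra.center k K) :
    ∃ J : LieIdeal k K, J ≤ LieAlgebra.center k K ∧ J ⊓ A = ⊥ ∧ A ⊔ J = B ∧
      finrank k A.toSubmodule + finrank k J.toSubmodule = finrank k B.toSubmodule := by
  obtain ⟨C, hdisj, hsup⟩ :=
    IsModularLattice.exists_disjoint_and_sup_eq (show A.toSubmodule ≤ B.toSubmodule from hAB)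
  have hCZ : C ≤ (LieAlgebra.center k K).toSubmodule :=
    (le_sup_right.trans hsup.le).trans (show B.toSubmodule ≤ _ from hB)
  let J : LieIdeal k K :=
    { C with
      lie_mem := fun {x m} hm ↦ by
        rw [show ⁅x, m⁆ = 0 from hCZ hm x]
        exact C.zero_mem }
  have hJ : J.toSubmodule = C := rfl
  refine ⟨J, hCZ, ?_, ?_, ?_⟩
  · rw [← LieSubmodule.toSubmodule_inj, LieSubmodule.inf_toSubmodule, hJ, inf_comm]
    exact hdisj.eq_bot
  · rw [← LieSubmodule.toSubmodule_inj, LieSubmodule.sup_toSubmodule, hJ, hsup]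
  · rw [hJ, ← hsup, ← Submodule.finrank_sup_add_finrank_inf_eq, hdisj.eq_bot, finrank_bot,
      add_zero]

end CoverLemmas

/-- Characterization of the covers of a `d`-generator generalized Heisenberg Lie algebra
with `d ≥ 3` and `dim L² = ½d(d−1) − 1`, where `μ = dim M(L) = (1/3)d(d−1)(d+1) − d + 1`. -/
theorem stmt15 (L : Type*) [LieRing L] [LieAlgebra k L] [FiniteDimensional k L]
    (d : ℕ) (hd3 : 3 ≤ d)
    (hH : LieModule.lowerCentralSeries k L L 1 = LieAlgebra.center k L)
    (hgen : finrank k (L ⧸ lieSq k L) = d)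
    (hrk : finrank k (lieSq k L) = d * (d - 1) / 2 - 1)
    (μ : ℕ) (hμ : (μ : ℤ) = (d : ℤ) * ((d : ℤ) - 1) * ((d : ℤ) + 1) / 3 - (d : ℤ) + 1)
    (Lstar : Type*) [LieRing Lstar] [LieAlgebra k Lstar] [FiniteDimensional k Lstar] :
    (∃ B : LieIdeal k Lstar,
        B ≤ LieAlgebra.center k Lstar ⊓ LieModule.lowerCentralSeries k Lstar Lstar 1 ∧
        finrank k B.toSubmodule = μ ∧
        Nonempty ((Lstar ⧸ B) ≃ₗ⁅k⁆ L)) ↔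
      ((LieModule.lowerCentralSeries k Lstar Lstar 3 = ⊥ ∧
          LieModule.lowerCentralSeries k Lstar Lstar 2 ≠ ⊥ ∧
          finrank k (LieModule.lowerCentralSeries k Lstar Lstar 2).toSubmodule = μ ∧
          LieAlgebra.center k Lstar ≤ LieModule.lowerCentralSeries k Lstar Lstar 1 ∧
          Nonempty ((Lstar ⧸ LieModule.lowerCentralSeries k Lstar Lstar 2) ≃ₗ⁅k⁆ L)) ∨
        (LieModule.lowerCentralSeries k Lstar Lstar 3 = ⊥ ∧
          LieModule.lowerCentralSeries k Lstar Lstar 2 ≠ ⊥ ∧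
          finrank k (LieModule.lowerCentralSeries k Lstar Lstar 2).toSubmodule = μ - 1 ∧
          LieAlgebra.center k Lstar ≤ LieModule.lowerCentralSeries k Lstar Lstar 1 ∧
          ∃ J : LieIdeal k Lstar,
            J ≤ LieAlgebra.center k Lstar ∧
            finrank k J.toSubmodule = 1 ∧
            J ⊓ LieModule.lowerCentralSeries k Lstar Lstar 2 = ⊥ ∧
            Nonempty ((Lstar ⧸ (LieModule.lowerCentralSeries k Lstar Lstar 2 ⊔ J)) ≃ₗ⁅k⁆ L))) := by
  have hμ6 : (6 : ℤ) ≤ μ := by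
    have hd : (3 : ℤ) ≤ d := by exact_mod_cast hd3
    have : (d : ℤ) + 5 ≤ d * (d - 1) * (d + 1) / 3 := by
      rw [Int.le_ediv_iff_mul_le (by norm_num)]
      nlinarith [mul_nonneg (sub_nonneg.2 hd) (sub_nonneg.2 hd),
        mul_nonneg (mul_nonneg (sub_nonneg.2 hd) (sub_nonneg.2 hd)) (sub_nonneg.2 hd)]
    omega
  constructor
  · rintro ⟨B, hB, hBμ, ⟨e⟩⟩
    have hBZ : B ≤ LieAlgebra.center k Lstar := hB.trans inf_le_left
    have hBD : B ≤ LieModule.lowerCentralSeries k Lstar Lstar 1 := hB.trans inf_le_right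
    obtain ⟨f, hf, hker⟩ : ∃ f : Lstar →ₗ⁅k⁆ L, Function.Surjective f ∧ f.ker = B := by
      let f : Lstar →ₗ⁅k⁆ L :=
        { (e : (Lstar ⧸ B) →ₗ[k] L) ∘ₗ (LieSubmodule.Quotient.mk' B : Lstar →ₗ[k] Lstar ⧸ B) with
          map_lie' := fun {x y} ↦ e.map_lie (LieSubmodule.Quotient.mk x) (LieSubmodule.Quotient.mk y) }
      refine ⟨f, e.surjective.comp (LieSubmodule.Quotient.surjective_mk' B), ?_⟩
      ext x
      rw [LieHom.mem_ker, ← LieSubmodule.Quotient.mk_eq_zero]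
      exact map_eq_zero_iff e e.injective
    have hcomap := comap_lowerCentralSeries_one hf (hker.trans_le hBD)
    have hL2 : LieModule.lowerCentralSeries k L L 2 = ⊥ := by
      rw [LieModule.lowerCentralSeries_succ, hH, LieSubmodule.lie_eq_bot_iff]
      exact fun x _ m hm ↦ hm x
    have hC : LieModule.lowerCentralSeries k Lstar Lstar 2 ≤ B := by
      rw [← hker, ← LieIdeal.map_eq_bot_iff, LieIdeal.lowerCentralSeries_map_eq 2 hf, hL2]
    have hclass : LieModule.lowerCentralSeries k Lstar Lstar 3 = ⊥ := by
      rw [LieModule.lowerCentralSeries_succ, LieSubmodule.lie_eq_bot_iff]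
      intro x _ m hm
      exact hBZ (hC hm) x
    have hcenter : LieAlgebra.center k Lstar ≤ LieModule.lowerCentralSeries k Lstar Lstar 1 := by
      rw [← hcomap, hH]
      intro z hz y
      obtain ⟨x, rfl⟩ := hf y
      rw [LieHom.coe_toLinearMap, ← f.map_lie, show ⁅x, z⁆ = 0 from hz x, map_zero]
    have hdimL : finrank k L + μ = finrank k Lstar := by
      rw [← (f : Lstar →ₗ[k] L).finrank_range_add_finrank_ker, LinearMap.range_eq_top.2 hf,
        finrank_top, ← LieHom.ker_toSubmodule, hker, hBμ]
    have hdimD : d + finrank k (lieSq k Lstar) = finrank k Lstar := by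
      let g : Lstar →ₗ[k] L ⧸ lieSq k L := (lieSq k L).mkQ ∘ₗ (f : Lstar →ₗ[k] L)
      have hg : Function.Surjective g := (lieSq k L).mkQ_surjective.comp hf
      have hgker : LinearMap.ker g = lieSq k Lstar := by
        rw [LinearMap.ker_comp, Submodule.ker_mkQ, lieSq, lieSq, ← hcomap]
        rfl
      rw [← g.finrank_range_add_finrank_ker, LinearMap.range_eq_top.2 hg, finrank_top, hgker, hgen]
    have hL := (lieSq k L).finrank_quotient_add_finrank
    have hquot : finrank k (Lstar ⧸ lieSq k Lstar) = d := by
      have := (lieSq k Lstar).finrank_quotient_add_finrank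
      omega
    have hle := finrank_lieSq_le (k := k) (K := Lstar)
    rw [hquot] at hle
    have hne : LieModule.lowerCentralSeries k Lstar Lstar 2 ≠ ⊥ := by
      intro h
      have : finrank k (LieModule.lowerCentralSeries k Lstar Lstar 2).toSubmodule = 0 := by
        rw [h, LieSubmodule.bot_toSubmodule, finrank_bot]
      omega
    obtain ⟨J, hJZ, hJC, hCJ, hdim⟩ := exists_central_complement hC hBZ
    by_cases hCμ : finrank k (LieModule.lowerCentralSeries k Lstar Lstar 2).toSubmodule = μ
    · have hCB : LieModule.lowerCentralSeries k Lstar Lstar 2 = B :=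
        LieSubmodule.toSubmodule_injective
          (Submodule.eq_of_le_of_finrank_eq hC (hCμ.trans hBμ.symm))
      exact Or.inl ⟨hclass, hne, hCμ, hcenter, hCB ▸ ⟨e⟩⟩
    · exact Or.inr ⟨hclass, hne, by omega, hcenter, J, hJZ, by omega, hJC, hCJ ▸ ⟨e⟩⟩
  · rintro (⟨hclass, -, hdim, -, he⟩ | ⟨hclass, -, hdim, hcenter, J, hJZ, hJ, hJC, he⟩)
    all_goals
      have hCZ : LieModule.lowerCentralSeries k Lstar Lstar 2 ≤ LieAlgebra.center k Lstar := by
        intro m hm x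
        exact (LieSubmodule.lie_eq_bot_iff _ _).1
          ((LieModule.lowerCentralSeries_succ k Lstar Lstar 2).symm.trans hclass) x
          (LieSubmodule.mem_top x) m hm
      have hCD := LieModule.antitone_lowerCentralSeries k Lstar Lstar (show 1 ≤ 2 by decide)
    · exact ⟨_, le_inf hCZ hCD, hdim, he⟩
    · refine ⟨_, sup_le (le_inf hCZ hCD) (le_inf hJZ (hJZ.trans hcenter)), ?_, he⟩
      have h := Submodule.finrank_sup_add_finrank_inf_eq
        (LieModule.lowerCentralSeries k Lstar Lstar 2).toSubmodule J.toSubmodule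
      rw [← LieSubmodule.sup_toSubmodule, ← LieSubmodule.inf_toSubmodule, inf_comm, hJC,
        LieSubmodule.bot_toSubmodule, finrank_bot] at h
      omega
end

section
/- Let L be a d-generator generalized Heisenberg Lie algebra over a field k with d ≥ 3 and dim L² = ½d(d−1) − 1, and let x₁, …, x_d ∈ L be elements whose images form a basis of L/L². Then for all indices 1 ≤ i < j < k ≤ d, the element [x_i,x_j]⊗(x_k+L²) + [x_j,x_k]⊗(x_i+L²) + [x_k,x_i]⊗(x_j+L²) of L² ⊗ (L/L²) is nonzero. -/
open Module TensorProduct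

variable (k : Type*) [Field k]

theorem card_filter_fst_lt_snd (d : ℕ) :
    (Finset.univ.filter fun p : Fin d × Fin d => p.1 < p.2).card = d * (d - 1) / 2 := by
  rw [← Finset.sum_range_id, ← Fin.sum_univ_eq_sum_range (fun i => i),
    Finset.card_filter, Fintype.sum_prod_type_right]
  refine Finset.sum_congr rfl fun b _ => ?_
  rw [← Finset.card_filter, Finset.filter_gt_eq_Iio, Fin.card_Iio]

/-- If `L²` is central and the images of the `x a` span `L/L²`, any subspace containing all
brackets `⁅x a, x b⁆` with `a < b` contains `L²`. -/
theorem lieSq_le_of_lie_mem {L : Type*} [LieRing L] [LieAlgebra k L] {ι : Type*} [LinearOrder ι]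
    (hH : LieModule.lowerCentralSeries k L L 1 ≤ LieAlgebra.center k L) (x : ι → L)
    (hsp : Submodule.span k
      (Set.range fun i => (Submodule.Quotient.mk (x i) : L ⧸ lieSq k L)) = ⊤)
    (S : Submodule k L) (hS : ∀ a b, a < b → ⁅x a, x b⁆ ∈ S) : lieSq k L ≤ S := by
  have hS' : ∀ a b, ⁅x a, x b⁆ ∈ S := fun a b => by
    rcases lt_trichotomy a b with h | rfl | h
    · exact hS a b h
    · simp
    · rw [← lie_skew]
      exact S.neg_mem (hS b a h)
  have hcentral : ∀ z ∈ lieSq k L, ∀ y : L, ⁅y, z⁆ = 0 := fun z hz y =>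
    (LieModule.mem_maxTrivSubmodule k L L z).1 (hH hz) y
  have hdecomp : ∀ y : L, ∃ u ∈ Submodule.span k (Set.range x), ∃ z ∈ lieSq k L, u + z = y := by
    intro y
    have hy : (lieSq k L).mkQ y ∈ (Submodule.span k (Set.range x)).map (lieSq k L).mkQ := by
      rw [Submodule.map_span, ← Set.range_comp]
      exact hsp.symm ▸ Submodule.mem_top
    obtain ⟨u, hu, huy⟩ := hy
    refine ⟨u, hu, y - u, ?_, by abel⟩
    rw [← Submodule.ker_mkQ (lieSq k L), LinearMap.mem_ker, map_sub, huy, sub_self]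
  have hspan : ∀ u ∈ Submodule.span k (Set.range x), ∀ v ∈ Submodule.span k (Set.range x),
      ⁅u, v⁆ ∈ S := by
    intro u hu v hv
    induction hu, hv using Submodule.span_induction₂ with
    | mem_mem u v hu hv =>
      obtain ⟨a, rfl⟩ := hu
      obtain ⟨b, rfl⟩ := hv
      exact hS' a b
    | zero_left => simp
    | zero_right => simp
    | add_left _ _ _ _ _ _ h₁ h₂ => rw [add_lie]; exact S.add_mem h₁ h₂
    | add_right _ _ _ _ _ _ h₁ h₂ => rw [lie_add]; exact S.add_mem h₁ h₂
    | smul_left r _ _ _ _ h => rw [smul_lie]; exact S.smul_mem r h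
    | smul_right r _ _ _ _ h => rw [lie_smul]; exact S.smul_mem r h
  have hlie : ∀ y y' : L, ⁅y, y'⁆ ∈ S := by
    intro y y'
    obtain ⟨u, hu, z, hz, rfl⟩ := hdecomp y
    obtain ⟨v, hv, w, hw, rfl⟩ := hdecomp y'
    rw [lie_add, hcentral w hw, add_lie, ← lie_skew z v, hcentral z hz]
    simpa using hspan u hu v hv
  rw [lieSq, LieModule.lowerCentralSeries_succ, LieModule.lowerCentralSeries_zero,
    LieSubmodule.lieIdeal_oper_eq_linear_span', Submodule.span_le]
  rintro _ ⟨y, -, y', -, rfl⟩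
  exact hlie y y'

/-- For a `d`-generator generalized Heisenberg Lie algebra with `d ≥ 3` and
`dim L² = ½d(d−1) − 1`, and elements `x₁, …, x_d` whose images form a basis of `L/L²`,
the element `[xᵢ,xⱼ]⊗x̄ₗ + [xⱼ,xₗ]⊗x̄ᵢ + [xₗ,xᵢ]⊗x̄ⱼ` of `L² ⊗ (L/L²)` is nonzero
whenever `i < j < l`. -/
theorem stmt19 (L : Type*) [LieRing L] [LieAlgebra k L] [FiniteDimensional k L]
    (d : ℕ) (hd3 : 3 ≤ d)
    (hH : LieModule.lowerCentralSeries k L L 1 = LieAlgebra.center k L)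
    (hgen : finrank k (L ⧸ lieSq k L) = d)
    (hrk : finrank k (lieSq k L) = d * (d - 1) / 2 - 1)
    (x : Fin d → L)
    (hli : LinearIndependent k
      (fun i : Fin d => (Submodule.Quotient.mk (x i) : L ⧸ lieSq k L)))
    (hsp : Submodule.span k
      (Set.range fun i : Fin d => (Submodule.Quotient.mk (x i) : L ⧸ lieSq k L)) = ⊤) :
    ∀ i j l : Fin d, i < j → j < l →
      (⟨⁅x i, x j⁆, lie_mem_lieSq k (x i) (x j)⟩ : lieSq k L) ⊗ₜ[k]
          (Submodule.Quotient.mk (x l) : L ⧸ lieSq k L)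
        + (⟨⁅x j, x l⁆, lie_mem_lieSq k (x j) (x l)⟩ : lieSq k L) ⊗ₜ[k]
          (Submodule.Quotient.mk (x i) : L ⧸ lieSq k L)
        + (⟨⁅x l, x i⁆, lie_mem_lieSq k (x l) (x i)⟩ : lieSq k L) ⊗ₜ[k]
          (Submodule.Quotient.mk (x j) : L ⧸ lieSq k L) ≠ 0 := by
  intro i j l hij hjl h0
  let b := Basis.mk hli hsp.ge
  have hb : ∀ a c, b.coord a (Submodule.Quotient.mk (x c)) = if a = c then 1 else 0 := by
    intro a c
    have : b c = Submodule.Quotient.mk (x c) := Basis.mk_apply hli hsp.ge c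
    rw [← this, Basis.coord_apply, Basis.repr_self, Finsupp.single_apply]
    simp only [eq_comm]
  have hproj : ∀ a, TensorProduct.rid k (lieSq k L) ((b.coord a).lTensor (lieSq k L) _) = _ :=
    fun a => congrArg (fun t => TensorProduct.rid k (lieSq k L)
      ((b.coord a).lTensor (lieSq k L) t)) h0
  have hij0 : ⁅x i, x j⁆ = 0 := by
    have := hproj l
    simpa [hb, hjl.ne', (hij.trans hjl).ne'] using this
  have hjl0 : ⁅x j, x l⁆ = 0 := by
    have := hproj i
    simpa [hb, hij.ne, (hij.trans hjl).ne] using this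
  let P := Finset.univ.filter fun p : Fin d × Fin d => p.1 < p.2
  let D : Finset (Fin d × Fin d) := {(i, j), (j, l)}
  have hD : D.card = 2 := Finset.card_pair (by simp [hij.ne])
  have hDP : D ⊆ P := by
    simp [D, P, Finset.insert_subset_iff, hij, hjl]
  have hcard : (P \ D).card = d * (d - 1) / 2 - 2 := by
    rw [Finset.card_sdiff_of_subset hDP, hD, card_filter_fst_lt_snd]
  classical
  have hle : lieSq k L ≤
      Submodule.span k (((P \ D).image fun p => ⁅x p.1, x p.2⁆ : Finset L) : Set L) := by
    refine lieSq_le_of_lie_mem k hH.le x hsp _ fun a c hac => ?_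
    by_cases hmem : (a, c) ∈ D
    · have : ⁅x a, x c⁆ = 0 := by
        simp only [D, Finset.mem_insert, Finset.mem_singleton, Prod.mk.injEq] at hmem
        rcases hmem with ⟨rfl, rfl⟩ | ⟨rfl, rfl⟩
        exacts [hij0, hjl0]
      rw [this]
      exact Submodule.zero_mem _
    · exact Submodule.subset_span (Finset.mem_coe.2 (Finset.mem_image.2
        ⟨(a, c), Finset.mem_sdiff.2 ⟨by simpa [P] using hac, hmem⟩, rfl⟩))
  have hfin := (Submodule.finrank_mono hle).trans
    ((finrank_span_finset_le_card _).trans Finset.card_image_le)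
  have hP : 2 ≤ d * (d - 1) / 2 := by
    rw [← card_filter_fst_lt_snd, ← hD]
    exact Finset.card_le_card hDP
  rw [hcard, hrk] at hfin
  omega
end
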